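/- Let a > 0, n a positive integer, and W̃ = 1·1ᵀ (all entries 1). Let v : [0,∞) → (0,1)^N be a solution of the gradient flow ∂_t v = −∇_v E(v,W̃) whose initial entries v_1(0), …, v_N(0) are pairwise distinct, and let σ be the permutation of {1,…,N} such that (v_{σ^{-1}(i)}(0))_{i=1,…,N} is increasing. Then v(t) converges as t → ∞ to the unique steady state v* given by v*_i = (σ(i) − 1/2)/N for i = 1, …, N, which is the global minimizer of E(·,W̃) compatible with the initial rank-order. -/

import Mathlib

open Filter Set

/-- Penaliser `Ψ̃_{a,n}(s) = a·((|s|−1)^(2n) − 1)`. -/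
noncomputable def psi (a : ℝ) (n : ℕ) (s : ℝ) : ℝ := a * ((|s| - 1) ^ (2 * n) - 1)

/-- Energy with weight matrix `W̃ = 1·1ᵀ`:
`E(v) = (1/2)·Σᵢ Σⱼ (Ψ̃(vⱼ−vᵢ) + Ψ̃(vⱼ+vᵢ))`. -/
noncomputable def energyOnes {N : ℕ} (a : ℝ) (n : ℕ) (v : Fin N → ℝ) : ℝ :=
  (1 / 2) * ∑ i, ∑ j, (psi a n (v j - v i) + psi a n (v j + v i))

/-- Up to the factor `-2an`, the derivative of `psi a n` away from the origin (with `p = 2n - 1`). -/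
noncomputable def repulsion (p : ℕ) (s : ℝ) : ℝ := Real.sign s * (1 - |s|) ^ p

lemma repulsion_zero (p : ℕ) : repulsion p 0 = 0 := by simp [repulsion]

lemma repulsion_of_pos (p : ℕ) {s : ℝ} (hs : 0 < s) : repulsion p s = (1 - s) ^ p := by
  simp [repulsion, Real.sign_of_pos hs, abs_of_pos hs]

lemma repulsion_neg (p : ℕ) (s : ℝ) : repulsion p (-s) = -repulsion p s := by
  simp [repulsion, Real.sign_neg]

lemma repulsion_of_neg (p : ℕ) {s : ℝ} (hs : s < 0) : repulsion p s = -(1 + s) ^ p := by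
  simp [repulsion, Real.sign_of_neg hs, abs_of_neg hs]

lemma psi_neg (a : ℝ) (n : ℕ) (s : ℝ) : psi a n (-s) = psi a n s := by simp [psi]

lemma pow_sub_pow_ge_of_abs_le_one {x y : ℝ} (p : ℕ) (hx : |x| ≤ 1) (hy : |y| ≤ 1) (hxy : x ≤ y) :
    -(p * (y - x)) ≤ x ^ p - y ^ p := by
  have h := abs_pow_sub_pow_le x y p
  have h1 : max |x| |y| ^ (p - 1) ≤ 1 := pow_le_one₀ (le_max_of_le_left (abs_nonneg x)) (max_le hx hy)
  have h2 : |x ^ p - y ^ p| ≤ |x - y| * p :=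
    h.trans (mul_le_of_le_one_right (by positivity) h1)
  rw [abs_of_nonpos (sub_nonpos.2 hxy)] at h2
  linarith [(abs_le.1 h2).1]

lemma repulsion_sub_ge {x y : ℝ} (p : ℕ) (hyx : y ≤ x) (hy : -1 ≤ y) (hx : x ≤ 2)
    (h : y ≤ 0 → x ≤ 1) : -(p * (x - y)) ≤ repulsion p x - repulsion p y := by
  rcases lt_or_ge 0 y with hy0 | hy0
  · rw [repulsion_of_pos p hy0, repulsion_of_pos p (hy0.trans_le hyx)]
    have := pow_sub_pow_ge_of_abs_le_one (x := 1 - x) (y := 1 - y) p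
      (abs_le.2 ⟨by linarith, by linarith⟩) (abs_le.2 ⟨by linarith, by linarith⟩) (by linarith)
    linarith
  rcases lt_or_ge x 0 with hx0 | hx0
  · rw [repulsion_of_neg p hx0, repulsion_of_neg p (hyx.trans_lt hx0)]
    have := pow_sub_pow_ge_of_abs_le_one (x := 1 + y) (y := 1 + x) p
      (abs_le.2 ⟨by linarith, by linarith⟩) (abs_le.2 ⟨by linarith, by linarith⟩) (by linarith)
    linarith
  have h1 : 0 ≤ repulsion p x := by
    rcases hx0.eq_or_lt with rfl | hx0
    · rw [repulsion_zero]
    · rw [repulsion_of_pos p hx0]; exact pow_nonneg (by linarith [h hy0]) p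
  have h2 : repulsion p y ≤ 0 := by
    rcases hy0.eq_or_lt with rfl | hy0
    · rw [repulsion_zero]
    · rw [repulsion_of_neg p hy0]; exact neg_nonpos.2 (pow_nonneg (by linarith) p)
  have h3 : 0 ≤ p * (x - y) := mul_nonneg p.cast_nonneg (by linarith)
  linarith

lemma pow_sub_mul_neg {p : ℕ} (hp : Odd p) {x y : ℝ} (hxy : x ≠ y) :
    ((1 - x) ^ p - (1 - y) ^ p) * (x - y) < 0 := by
  rcases hxy.lt_or_gt with h | h
  · have := hp.strictMono_pow (show 1 - y < 1 - x by linarith)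
    exact mul_neg_of_pos_of_neg (by simpa using this) (by linarith)
  · have := hp.strictMono_pow (show 1 - x < 1 - y by linarith)
    exact mul_neg_of_neg_of_pos (by simpa using this) (by linarith)

lemma pow_sub_mul_nonpos {p : ℕ} (hp : Odd p) (x y : ℝ) :
    ((1 - x) ^ p - (1 - y) ^ p) * (x - y) ≤ 0 := by
  rcases eq_or_ne x y with rfl | h
  · simp
  · exact (pow_sub_mul_neg hp h).le

lemma repulsion_sub_mul_nonpos {p : ℕ} (hp : Odd p) {x y : ℝ} (h : SignType.sign x = SignType.sign y) :
    (repulsion p x - repulsion p y) * (x - y) ≤ 0 := by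
  rcases lt_trichotomy x 0 with hx | rfl | hx
  · have hy : y < 0 := sign_eq_neg_one_iff.1 (h ▸ sign_neg hx)
    rw [repulsion_of_neg p hx, repulsion_of_neg p hy]
    have := pow_sub_mul_nonpos hp (-x) (-y)
    simp only [sub_neg_eq_add] at this
    linarith
  · have hy : y = 0 := by simpa using h.symm
    simp [hy]
  · have hy : 0 < y := sign_eq_one_iff.1 (h ▸ sign_pos hx)
    rw [repulsion_of_pos p hx, repulsion_of_pos p hy]
    exact pow_sub_mul_nonpos hp x y

lemma hasDerivAt_psi (a : ℝ) (m : ℕ) {s : ℝ} (hs : s ≠ 0) :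
    HasDerivAt (psi a (m + 1)) (-(2 * a * (m + 1)) * repulsion (2 * m + 1) s) s := by
  have h1 : HasDerivAt (fun x : ℝ => |x|) (SignType.sign s : ℝ) s := hasDerivAt_abs hs
  have h2 := (((h1.sub_const 1).pow (2 * (m + 1))).sub_const 1).const_mul a
  refine h2.congr_deriv ?_
  have e : 2 * (m + 1) - 1 = 2 * m + 1 := by omega
  have o : Odd (2 * m + 1) := odd_two_mul_add_one m
  rcases lt_or_gt_of_ne hs with h | h
  · rw [repulsion_of_neg _ h, sign_neg h, abs_of_neg h, e,
      show -s - 1 = -(1 + s) by ring, o.neg_pow]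
    simp only [SignType.coe_neg_one, Nat.cast_mul, Nat.cast_add, Nat.cast_ofNat,
      Nat.cast_one]
    ring
  · rw [repulsion_of_pos _ h, sign_pos h, abs_of_pos h, e,
      show s - 1 = -(1 - s) by ring, o.neg_pow]
    simp only [SignType.coe_one, Nat.cast_mul, Nat.cast_add, Nat.cast_ofNat,
      Nat.cast_one]
    ring

lemma pow_tangent_lt (m : ℕ) {x y : ℝ} (hxy : x ≠ y) :
    (2 * (m + 1) : ℝ) * y ^ (2 * m + 1) * (x - y) < x ^ (2 * (m + 1)) - y ^ (2 * (m + 1)) := by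
  have hc : StrictConvexOn ℝ Set.univ fun z : ℝ => z ^ (2 * (m + 1)) :=
    Even.strictConvexOn_pow (even_two_mul _) (by omega)
  have hd : HasDerivAt (fun z : ℝ => z ^ (2 * (m + 1))) ((2 * (m + 1) : ℝ) * y ^ (2 * m + 1)) y := by
    have := hasDerivAt_pow (2 * (m + 1)) y
    rw [show 2 * (m + 1) - 1 = 2 * m + 1 by omega] at this
    exact_mod_cast this
  rcases hxy.lt_or_gt with h | h
  · have := hc.slope_lt_of_hasDerivAt (Set.mem_univ _) (Set.mem_univ _) h hd
    rw [slope_def_field, div_lt_iff₀ (by linarith)] at this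
    linarith
  · have := hc.lt_slope_of_hasDerivAt (Set.mem_univ _) (Set.mem_univ _) h hd
    rw [slope_def_field, lt_div_iff₀ (by linarith)] at this
    linarith

lemma psi_tangent_lt_of_pos {a : ℝ} (ha : 0 < a) (m : ℕ) {x y : ℝ} (hx : 0 < x) (hy : 0 < y)
    (hxy : x ≠ y) :
    -(2 * a * (m + 1)) * repulsion (2 * m + 1) y * (x - y) < psi a (m + 1) x - psi a (m + 1) y := by
  have h := mul_lt_mul_of_pos_left
    (pow_tangent_lt m (x := x - 1) (y := y - 1) (by simpa using hxy)) ha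
  rw [repulsion_of_pos _ hy, psi, psi, abs_of_pos hx, abs_of_pos hy,
    show 1 - y = -(y - 1) by ring, (odd_two_mul_add_one m).neg_pow]
  linarith

lemma psi_tangent_le {a : ℝ} (ha : 0 < a) (m : ℕ) {x y : ℝ}
    (h : SignType.sign x = SignType.sign y) :
    -(2 * a * (m + 1)) * repulsion (2 * m + 1) y * (x - y) ≤ psi a (m + 1) x - psi a (m + 1) y := by
  rcases eq_or_ne x y with rfl | hxy
  · simp
  rcases lt_trichotomy x 0 with hx | rfl | hx
  · have hy : y < 0 := sign_eq_neg_one_iff.1 (h ▸ sign_neg hx)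
    have := psi_tangent_lt_of_pos ha m (neg_pos.2 hx) (neg_pos.2 hy) (by simpa using hxy)
    rw [psi_neg, psi_neg, repulsion_neg] at this
    linarith
  · exact absurd (by simpa using h.symm) hxy.symm
  · exact (psi_tangent_lt_of_pos ha m hx (sign_eq_one_iff.1 (h ▸ sign_pos hx)) hxy).le

lemma two_mul_sum_mul_sum {ι : Type*} [Fintype ι] (A B : ι → ι → ℝ)
    (hA : ∀ i j, A j i = -A i j) (hB : ∀ i j, B j i = B i j) (u : ι → ℝ) :
    ∑ i, ∑ j, (A i j * (u i - u j) + B i j * (u i + u j)) =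
      2 * ∑ i, u i * ∑ j, (A i j + B i j) := by
  have h : ∑ i, ∑ j, u j * (B i j - A i j) = ∑ i, ∑ j, u i * (A i j + B i j) := by
    rw [Finset.sum_comm]
    refine Finset.sum_congr rfl fun i _ => Finset.sum_congr rfl fun j _ => ?_
    rw [hA i j, hB i j]; ring
  have h2 : ∑ i, u i * ∑ j, (A i j + B i j) = ∑ i, ∑ j, u i * (A i j + B i j) := by
    simp only [Finset.mul_sum]
  rw [h2, two_mul]
  nth_rewrite 2 [← h]
  rw [← Finset.sum_add_distrib]
  refine Finset.sum_congr rfl fun i _ => ?_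
  rw [← Finset.sum_add_distrib]
  exact Finset.sum_congr rfl fun j _ => by ring

/-- The total repulsion felt by particle `i` from the other particles and all mirror images. -/
noncomputable def totalRepulsion {N : ℕ} (p : ℕ) (v : Fin N → ℝ) (i : Fin N) : ℝ :=
  ∑ j, (repulsion p (v i - v j) + repulsion p (v i + v j))

lemma sum_repulsion_mul {N : ℕ} (p : ℕ) (v u : Fin N → ℝ) :
    ∑ i, ∑ j, (repulsion p (v i - v j) * (u i - u j) + repulsion p (v i + v j) * (u i + u j)) =
      2 * ∑ i, u i * totalRepulsion p v i :=
  two_mul_sum_mul_sum (fun i j => repulsion p (v i - v j)) (fun i j => repulsion p (v i + v j))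
    (fun i j => by rw [← repulsion_neg, neg_sub]) (fun i j => by rw [add_comm]) u

lemma hasFDerivAt_energyOnes {N : ℕ} (a : ℝ) (m : ℕ) {v : Fin N → ℝ} (hpos : ∀ i, 0 < v i)
    (hinj : Function.Injective v) :
    HasFDerivAt (energyOnes a (m + 1))
      ((1 / 2 : ℝ) • ∑ i, ∑ j,
        ((-(2 * a * (m + 1)) * repulsion (2 * m + 1) (v j - v i)) •
            (ContinuousLinearMap.proj (R := ℝ) (φ := fun _ : Fin N => ℝ) j -
              ContinuousLinearMap.proj i) +
          (-(2 * a * (m + 1)) * repulsion (2 * m + 1) (v j + v i)) •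
            (ContinuousLinearMap.proj (R := ℝ) (φ := fun _ : Fin N => ℝ) j +
              ContinuousLinearMap.proj i))) v := by
  have hp (i : Fin N) : HasFDerivAt (fun w : Fin N → ℝ => w i)
      (ContinuousLinearMap.proj (R := ℝ) (φ := fun _ : Fin N => ℝ) i) v :=
    (ContinuousLinearMap.proj (R := ℝ) (φ := fun _ : Fin N => ℝ) i).hasFDerivAt
  refine HasFDerivAt.const_mul ?_ _
  refine HasFDerivAt.fun_sum fun i _ => HasFDerivAt.fun_sum fun j _ => HasFDerivAt.add ?_ ?_
  · rcases eq_or_ne j i with rfl | hji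
    · simpa using hasFDerivAt_const (psi a (m + 1) 0) v
    · exact (hasDerivAt_psi a m (sub_ne_zero.2 (hinj.ne hji))).comp_hasFDerivAt
        (f := fun w => w j - w i) v ((hp j).sub (hp i))
  · exact (hasDerivAt_psi a m (add_pos (hpos j) (hpos i)).ne').comp_hasFDerivAt
      (f := fun w => w j + w i) v ((hp j).add (hp i))

lemma fderiv_energyOnes_single {N : ℕ} (a : ℝ) (m : ℕ) {v : Fin N → ℝ} (hpos : ∀ i, 0 < v i)
    (hinj : Function.Injective v) (k : Fin N) :
    fderiv ℝ (energyOnes a (m + 1) (N := N)) v (Pi.single k 1) =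
      -(2 * a * (m + 1) * totalRepulsion (2 * m + 1) v k) := by
  have h := sum_repulsion_mul (2 * m + 1) v (Pi.single k 1)
  have hk : ∑ i, (Pi.single k 1 : Fin N → ℝ) i * totalRepulsion (2 * m + 1) v i =
      totalRepulsion (2 * m + 1) v k := by simp [Pi.single_apply]
  rw [Finset.sum_comm, hk] at h
  rw [(hasFDerivAt_energyOnes a m hpos hinj).fderiv]
  simp only [smul_apply, sum_apply,
    add_apply, sub_apply, ContinuousLinearMap.proj_apply,
    smul_eq_mul, mul_assoc, ← mul_add, ← Finset.mul_sum]
  rw [h]; ring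

lemma sum_repulsion_equispaced {p : ℕ} (hp : Odd p) (m r : ℕ) {M : ℝ} (hM : M = m + 1 + r) :
    ∑ l ∈ Finset.range (m + 1 + r),
      (repulsion p ((m - l) / M) + repulsion p ((m + l + 1) / M)) = 0 := by
  have hM0 : 0 < M := by rw [hM]; positivity
  set g : ℕ → ℝ := fun l => ((l + 1) / M) ^ p with hg
  have h1 : ∑ l ∈ Finset.range (m + 1 + r), repulsion p ((m - l) / M) =
      ∑ l ∈ Finset.range m, g (r + l) - ∑ l ∈ Finset.range r, g (m + l) := by
    rw [Finset.sum_range_add, Finset.sum_range_succ, sub_self, zero_div, repulsion_zero, add_zero,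
      sub_eq_add_neg, ← Finset.sum_neg_distrib, ← Finset.sum_range_reflect _ r]
    congr 1
    · refine Finset.sum_congr rfl fun l hl => ?_
      have hl : (l : ℝ) < m := by exact_mod_cast Finset.mem_range.1 hl
      rw [repulsion_of_pos _ (div_pos (by linarith) hM0), hg]
      congr 1
      field_simp
      rw [hM]; push_cast; ring
    · refine Finset.sum_congr rfl fun l hl => ?_
      have hl := Finset.mem_range.1 hl
      obtain ⟨k, rfl⟩ : ∃ k, r = l + 1 + k := ⟨r - (l + 1), by omega⟩
      have e : l + 1 + k - 1 - l = k := by omega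
      have hk : ((m : ℝ) - (m + 1 + (l + 1 + k - 1 - l) : ℕ)) / M < 0 :=
        div_neg_of_neg_of_pos (by push_cast; linarith [(l + 1 + k - 1 - l).cast_nonneg (α := ℝ)]) hM0
      rw [repulsion_of_neg _ hk, hg, e]
      congr 2
      field_simp
      rw [hM]; push_cast; ring
  have h2 : ∑ l ∈ Finset.range (m + 1 + r), repulsion p ((m + l + 1) / M) =
      ∑ l ∈ Finset.range r, g l - ∑ l ∈ Finset.range m, g l := by
    have hF (l : ℕ) : repulsion p ((m + l + 1) / M) = ((r - l) / M) ^ p := by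
      rw [repulsion_of_pos _ (by positivity)]
      congr 1
      field_simp
      rw [hM]; ring
    simp only [hF]
    rw [show m + 1 + r = r + 1 + m by ring, Finset.sum_range_add, Finset.sum_range_succ, sub_self,
      zero_div, zero_pow hp.pos.ne', add_zero, sub_eq_add_neg, ← Finset.sum_neg_distrib,
      ← Finset.sum_range_reflect g r]
    congr 1
    · refine Finset.sum_congr rfl fun l hl => ?_
      have hl := Finset.mem_range.1 hl
      obtain ⟨k, rfl⟩ : ∃ k, r = l + 1 + k := ⟨r - (l + 1), by omega⟩
      have e : l + 1 + k - 1 - l = k := by omega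
      rw [hg, e]
      push_cast; ring_nf
    · refine Finset.sum_congr rfl fun l _ => ?_
      rw [hg, ← hp.neg_pow]
      push_cast; ring_nf
  have h3 := Finset.sum_range_add g r m
  rw [add_comm r m, Finset.sum_range_add g m r] at h3
  rw [Finset.sum_add_distrib, h1, h2]
  linarith

lemma totalRepulsion_equispaced {p : ℕ} (hp : Odd p) {N : ℕ} (σ : Equiv.Perm (Fin N))
    {z : Fin N → ℝ} (hz : ∀ i, z i = (((σ i : ℕ) : ℝ) + 1 / 2) / N) (i : Fin N) :
    totalRepulsion p z i = 0 := by
  obtain ⟨r, hr⟩ : ∃ r, N = (σ i : ℕ) + 1 + r := ⟨N - (σ i + 1), by omega⟩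
  rw [← sum_repulsion_equispaced hp (σ i) r (M := N) (by exact_mod_cast hr), ← hr,
    ← Fin.sum_univ_eq_sum_range
      (fun l : ℕ => repulsion p (((σ i : ℕ) - l) / (N : ℝ)) +
        repulsion p (((σ i : ℕ) + l + 1) / (N : ℝ))) N, ← Equiv.sum_comp σ, totalRepulsion]
  refine Finset.sum_congr rfl fun j _ => ?_
  rw [hz i, hz j]
  congr 2 <;> ring

lemma totalRepulsion_sub_ge {N : ℕ} (p : ℕ) {v : Fin N → ℝ} (hv : ∀ i, v i ∈ Ioo (0 : ℝ) 1)
    {i j : Fin N} (hij : v i ≤ v j) :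
    -(2 * N * p * (v j - v i)) ≤ totalRepulsion p v j - totalRepulsion p v i := by
  rw [totalRepulsion, totalRepulsion, ← Finset.sum_sub_distrib]
  have h : ∀ k ∈ Finset.univ, -(2 * p * (v j - v i)) ≤
      (repulsion p (v j - v k) + repulsion p (v j + v k)) -
        (repulsion p (v i - v k) + repulsion p (v i + v k)) := by
    intro k _
    have hi := hv i
    have hj := hv j
    have hk := hv k
    simp only [Set.mem_Ioo] at hi hj hk
    have h1 := repulsion_sub_ge (x := v j - v k) (y := v i - v k) p (by linarith) (by linarith)
      (by linarith) (fun _ => by linarith)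
    have h2 := repulsion_sub_ge (x := v j + v k) (y := v i + v k) p (by linarith) (by linarith)
      (by linarith) (fun _ => by linarith)
    linarith
  have := Finset.sum_le_sum h
  rw [Finset.sum_const, Finset.card_univ, Fintype.card_fin, nsmul_eq_mul] at this
  linarith

/-- The repulsive flow does not let particles collide, so it preserves their rank-order. -/
lemma lt_of_repulsive_flow {N p : ℕ} {c : ℝ} (hc : 0 ≤ c) {v : ℝ → Fin N → ℝ}
    (hv : ∀ t, 0 ≤ t → ∀ i, v t i ∈ Ioo (0 : ℝ) 1)
    (hcont : ∀ t, 0 ≤ t → ∀ i, ContinuousAt (fun s => v s i) t)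
    (hderiv : ∀ t, 0 ≤ t → Function.Injective (v t) → ∀ i,
      HasDerivAt (fun s => v s i) (c * totalRepulsion p (v t) i) t)
    (hinj : Function.Injective (v 0)) {t : ℝ} (ht : 0 ≤ t) {i j : Fin N} (hij : v 0 i < v 0 j) :
    v t i < v t j := by
  by_contra! hcon
  set B : Set ℝ := {t | 0 ≤ t ∧ ∃ i j, v 0 i < v 0 j ∧ v t j ≤ v t i}
  have hBne : B.Nonempty := ⟨t, ht, i, j, hij, hcon⟩
  have hBbdd : BddBelow B := ⟨0, fun s hs => hs.1⟩
  set T := sInf B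
  have hT : 0 ≤ T := le_csInf hBne fun s hs => hs.1
  have hord : ∀ s, 0 ≤ s → s < T → ∀ i j, v 0 i < v 0 j → v s i < v s j := by
    intro s hs hsT i j h
    by_contra! h'
    exact absurd (csInf_le hBbdd ⟨hs, i, j, h, h'⟩) (not_le.2 hsT)
  have hinjs : ∀ s, 0 ≤ s → s < T → Function.Injective (v s) := by
    intro s hs hsT i j h
    by_contra hne
    rcases (hinj.ne hne).lt_or_gt with h' | h'
    · exact (hord s hs hsT _ _ h').ne h
    · exact (hord s hs hsT _ _ h').ne' h
  have hTord : ∀ i j, v 0 i < v 0 j → v T i < v T j := by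
    intro i j h
    set K : ℝ := c * (2 * N * p)
    have hmono : MonotoneOn (fun s => (v s j - v s i) * Real.exp (K * s)) (Icc 0 T) := by
      refine monotoneOn_of_hasDerivWithinAt_nonneg (convex_Icc 0 T)
        (f' := fun s => (c * totalRepulsion p (v s) j - c * totalRepulsion p (v s) i) *
          Real.exp (K * s) + (v s j - v s i) * (Real.exp (K * s) * K)) ?_ ?_ ?_
      · intro s hs
        exact (((hcont s hs.1 j).sub (hcont s hs.1 i)).mul (by fun_prop)).continuousWithinAt
      · intro s hs
        rw [interior_Icc] at hs
        have hd := hderiv s hs.1.le (hinjs s hs.1.le hs.2)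
        have he : HasDerivAt (fun s => Real.exp (K * s)) (Real.exp (K * s) * K) s := by
          simpa using ((hasDerivAt_id s).const_mul K).exp
        exact (((hd j).sub (hd i)).mul he).hasDerivWithinAt
      · intro s hs
        rw [interior_Icc] at hs
        have h1 := totalRepulsion_sub_ge p (hv s hs.1.le) (hord s hs.1.le hs.2 i j h).le
        have h2 := mul_le_mul_of_nonneg_left h1 hc
        have h3 : 0 ≤ (c * totalRepulsion p (v s) j - c * totalRepulsion p (v s) i) +
            (v s j - v s i) * K := by simp only [K]; linarith
        have := mul_nonneg h3 (Real.exp_pos (K * s)).le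
        linarith
    have := hmono (left_mem_Icc.2 hT) (right_mem_Icc.2 hT) hT
    simp only [mul_zero, Real.exp_zero, mul_one] at this
    have := pos_of_mul_pos_left ((sub_pos.2 h).trans_le this) (Real.exp_pos _).le
    linarith
  have hev : ∀ᶠ s in nhds T, ∀ i j, v 0 i < v 0 j → v s i < v s j := by
    refine eventually_all.2 fun i => eventually_all.2 fun j => ?_
    by_cases h : v 0 i < v 0 j
    · filter_upwards [(hcont T hT i).eventually_lt (hcont T hT j) (hTord i j h)] with s hs _
      exact hs
    · exact Eventually.of_forall fun s h' => absurd h' h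
  obtain ⟨ε, hε, hs⟩ := Metric.eventually_nhds_iff.1 hev
  obtain ⟨b, hbB, hb⟩ := exists_lt_of_csInf_lt hBne (show sInf B < T + ε by linarith)
  have hTb : T ≤ b := csInf_le hBbdd hbB
  obtain ⟨_, i, j, h, h'⟩ := hbB
  refine absurd (hs ?_ i j h) (not_lt.2 h')
  rw [Real.dist_eq, abs_of_nonneg (by linarith)]
  linarith

lemma eventually_lt_of_deriv_le_neg {V V' : ℝ → ℝ} {ε δ : ℝ} (hδ : 0 < δ)
    (hV : ∀ t, 0 ≤ t → 0 ≤ V t) (hd : ∀ t, 0 ≤ t → HasDerivAt V (V' t) t)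
    (hnonpos : ∀ t, 0 ≤ t → V' t ≤ 0) (h : ∀ t, 0 ≤ t → ε ≤ V t → V' t ≤ -δ) :
    ∀ᶠ t in atTop, V t < ε := by
  have hanti : AntitoneOn V (Ici 0) :=
    antitoneOn_of_hasDerivWithinAt_nonpos (convex_Ici 0)
      (fun t ht => (hd t ht).continuousAt.continuousWithinAt)
      (fun t ht => (hd t (interior_subset ht)).hasDerivWithinAt)
      (fun t ht => hnonpos t (interior_subset ht))
  obtain ⟨T, hT, hVT⟩ : ∃ T, 0 ≤ T ∧ V T < ε := by
    by_contra! hcon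
    have hlin : AntitoneOn (fun t => V t + δ * t) (Ici 0) := by
      have hd' : ∀ t, 0 ≤ t → HasDerivAt (fun t => V t + δ * t) (V' t + δ * 1) t :=
        fun t ht => (hd t ht).add ((hasDerivAt_id t).const_mul δ)
      refine antitoneOn_of_hasDerivWithinAt_nonpos (convex_Ici 0)
        (fun t ht => (hd' t ht).continuousAt.continuousWithinAt)
        (fun t ht => (hd' t (interior_subset ht)).hasDerivWithinAt) fun t ht => ?_
      have ht : 0 ≤ t := interior_subset ht
      linarith [h t ht (hcon t ht)]
    have hT : 0 ≤ (V 0 + 1) / δ := div_nonneg (by linarith [hV 0 le_rfl]) hδ.le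
    have := hlin self_mem_Ici hT hT
    simp only [mul_zero, add_zero, mul_div_cancel₀ _ hδ.ne'] at this
    linarith [hV _ hT]
  filter_upwards [eventually_ge_atTop T] with t ht
  exact (hanti hT (hT.trans ht) ht).trans_lt hVT

lemma sign_sub_eq_of_same_order {ι κ : Type*} [LinearOrder κ] {σ : ι → κ}
    (hσ : Function.Injective σ) {w z : ι → ℝ} (hw : ∀ i j, σ i < σ j → w i < w j)
    (hz : ∀ i j, σ i < σ j → z i < z j) (i j : ι) :
    SignType.sign (w i - w j) = SignType.sign (z i - z j) := by
  rcases lt_trichotomy (σ i) (σ j) with h | h | h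
  · rw [sign_neg (sub_neg.2 (hw i j h)), sign_neg (sub_neg.2 (hz i j h))]
  · simp [hσ h]
  · rw [sign_pos (sub_pos.2 (hw j i h)), sign_pos (sub_pos.2 (hz j i h))]

lemma sign_add_eq_of_pos {ι : Type*} {w z : ι → ℝ} (hw : ∀ i, 0 < w i) (hz : ∀ i, 0 < z i)
    (i j : ι) : SignType.sign (w i + w j) = SignType.sign (z i + z j) := by
  rw [sign_pos (add_pos (hw i) (hw j)), sign_pos (add_pos (hz i) (hz j))]

lemma energyOnes_lt {N : ℕ} {a : ℝ} (ha : 0 < a) (m : ℕ) {w z : Fin N → ℝ} (hw : ∀ i, 0 < w i)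
    (hz : ∀ i, 0 < z i)
    (hwz : ∀ i j, SignType.sign (w i - w j) = SignType.sign (z i - z j))
    (hcrit : ∀ i, totalRepulsion (2 * m + 1) z i = 0) (hne : w ≠ z) :
    energyOnes a (m + 1) z < energyOnes a (m + 1) w := by
  set c : ℝ := -(2 * a * (m + 1))
  have h0 : ∑ i, ∑ j, (c * repulsion (2 * m + 1) (z j - z i) * ((w j - w i) - (z j - z i)) +
      c * repulsion (2 * m + 1) (z j + z i) * ((w j + w i) - (z j + z i))) = 0 := by
    have h := sum_repulsion_mul (2 * m + 1) z (fun i => w i - z i)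
    simp only [hcrit, mul_zero, Finset.sum_const_zero] at h
    rw [Finset.sum_comm, ← mul_zero c, ← h]
    simp only [Finset.mul_sum]
    exact Finset.sum_congr rfl fun i _ => Finset.sum_congr rfl fun j _ => by ring
  have hle (i j : Fin N) :
      c * repulsion (2 * m + 1) (z j - z i) * ((w j - w i) - (z j - z i)) +
        c * repulsion (2 * m + 1) (z j + z i) * ((w j + w i) - (z j + z i)) ≤
      (psi a (m + 1) (w j - w i) + psi a (m + 1) (w j + w i)) -
        (psi a (m + 1) (z j - z i) + psi a (m + 1) (z j + z i)) := by
    have h1 := psi_tangent_le ha m (hwz j i)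
    have h2 := psi_tangent_le ha m (sign_add_eq_of_pos hw hz j i)
    simp only [c]
    linarith
  obtain ⟨k, hk⟩ := Function.ne_iff.1 hne
  have hlt : ∑ i, ∑ j, (c * repulsion (2 * m + 1) (z j - z i) * ((w j - w i) - (z j - z i)) +
      c * repulsion (2 * m + 1) (z j + z i) * ((w j + w i) - (z j + z i))) <
      ∑ i, ∑ j, ((psi a (m + 1) (w j - w i) + psi a (m + 1) (w j + w i)) -
        (psi a (m + 1) (z j - z i) + psi a (m + 1) (z j + z i))) := by
    refine Finset.sum_lt_sum (fun i _ => Finset.sum_le_sum fun j _ => hle i j)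
      ⟨k, Finset.mem_univ k, Finset.sum_lt_sum (fun j _ => hle k j) ⟨k, Finset.mem_univ k, ?_⟩⟩
    have := psi_tangent_lt_of_pos ha m (add_pos (hw k) (hw k)) (add_pos (hz k) (hz k))
      (fun h => hk (by linarith))
    simp only [sub_self, mul_zero, zero_add, c]
    linarith
  rw [h0] at hlt
  simp only [Finset.sum_sub_distrib] at hlt
  rw [energyOnes, energyOnes]
  linarith

lemma two_mul_sum_mul_totalRepulsion_le {N p : ℕ} (hp : Odd p) {w z : Fin N → ℝ}
    (hw : ∀ i, 0 < w i) (hz : ∀ i, 0 < z i)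
    (hwz : ∀ i j, SignType.sign (w i - w j) = SignType.sign (z i - z j))
    (hcrit : ∀ i, totalRepulsion p z i = 0) :
    2 * ∑ i, (w i - z i) * totalRepulsion p w i ≤
      ∑ i, ((1 - (w i + w i)) ^ p - (1 - (z i + z i)) ^ p) * ((w i + w i) - (z i + z i)) := by
  have h := sum_repulsion_mul p z (fun i => w i - z i)
  simp only [hcrit, mul_zero, Finset.sum_const_zero] at h
  rw [← sum_repulsion_mul p w (fun i => w i - z i), ← sub_zero (∑ i, ∑ j, _), ← h]
  simp only [← Finset.sum_sub_distrib]
  refine Finset.sum_le_sum fun i _ => ?_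
  have hle (j : Fin N) :
      (repulsion p (w i - w j) * (w i - z i - (w j - z j)) +
        repulsion p (w i + w j) * (w i - z i + (w j - z j))) -
      (repulsion p (z i - z j) * (w i - z i - (w j - z j)) +
        repulsion p (z i + z j) * (w i - z i + (w j - z j))) ≤ 0 := by
    have h1 := repulsion_sub_mul_nonpos hp (hwz i j)
    have h2 := repulsion_sub_mul_nonpos hp (sign_add_eq_of_pos hw hz i j)
    linarith
  have := Finset.single_le_sum (fun j _ => neg_nonneg.2 (hle j)) (Finset.mem_univ i)
  rw [Finset.sum_neg_distrib, neg_le_neg_iff] at this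
  refine this.trans (le_of_eq ?_)
  rw [repulsion_of_pos p (add_pos (hw i) (hw i)), repulsion_of_pos p (add_pos (hz i) (hz i))]
  ring

lemma exists_dissipation_bound {N p : ℕ} (hp : Odd p) (z : Fin N → ℝ) {ε : ℝ} (hε : 0 < ε) :
    ∃ δ > 0, ∀ w : Fin N → ℝ, (∀ i, w i ∈ Icc (0 : ℝ) 1) → ε ≤ ∑ i, (w i - z i) ^ 2 →
      ∑ i, ((1 - (w i + w i)) ^ p - (1 - (z i + z i)) ^ p) * ((w i + w i) - (z i + z i)) ≤ -δ := by
  set K : Set (Fin N → ℝ) :=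
    Set.pi Set.univ (fun _ => Icc (0 : ℝ) 1) ∩ {w | ε ≤ ∑ i, (w i - z i) ^ 2}
  have hK : IsCompact K := (isCompact_univ_pi fun _ => isCompact_Icc).inter_right
    (isClosed_le continuous_const (by fun_prop))
  rcases K.eq_empty_or_nonempty with hemp | hne
  · refine ⟨1, one_pos, fun w hw hwε => ?_⟩
    exact absurd (show w ∈ K from ⟨fun i _ => hw i, hwε⟩) (by simp [hemp])
  obtain ⟨w₀, hw₀, hmax⟩ := hK.exists_isMaxOn hne (f := fun w : Fin N → ℝ =>
    ∑ i, ((1 - (w i + w i)) ^ p - (1 - (z i + z i)) ^ p) * ((w i + w i) - (z i + z i)))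
    (by fun_prop)
  refine ⟨_, ?_, fun w hw hwε => (hmax (show w ∈ K from ⟨fun i _ => hw i, hwε⟩)).trans
    (neg_neg _).ge⟩
  obtain ⟨k, hk⟩ : ∃ k, w₀ k ≠ z k := by
    by_contra! h
    have : ε ≤ ∑ i, (w₀ i - z i) ^ 2 := hw₀.2
    simp only [h, sub_self, ne_eq, OfNat.ofNat_ne_zero, not_false_eq_true, zero_pow,
      Finset.sum_const_zero] at this
    linarith
  exact neg_pos.2 (Finset.sum_neg' (fun i _ => pow_sub_mul_nonpos hp _ _)
    ⟨k, Finset.mem_univ k, pow_sub_mul_neg hp fun h => hk (by linarith)⟩)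

/-- With `W̃ = 1·1ᵀ`, a gradient-flow solution in `(0,1)^N` with pairwise
distinct initial entries converges to the steady state `v*ᵢ = (σ(i) − 1/2)/N` (1-based), where
`σ` sorts the initial data; `v*` is the global minimizer of the energy among vectors in
`(0,1)^N` with the same rank-order. -/
theorem stmt12 (a : ℝ) (ha : 0 < a) (n : ℕ) (hn : 0 < n) (N : ℕ) (hN : 1 ≤ N)
    (v : ℝ → Fin N → ℝ)
    (hmem : ∀ t ∈ Set.Ici (0 : ℝ), ∀ i, v t i ∈ Set.Ioo (0 : ℝ) 1)
    (hode : ∀ t ∈ Set.Ici (0 : ℝ), ∀ i, HasDerivAt (fun s => v s i)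
      (-(fderiv ℝ (energyOnes a n (N := N)) (v t) (Pi.single i 1))) t)
    (hdist : ∀ i j, i ≠ j → v 0 i ≠ v 0 j)
    (σ : Equiv.Perm (Fin N))
    (hσ : StrictMono (fun i => v 0 (σ.symm i)))
    (vstar : Fin N → ℝ)
    (hvstar : ∀ i, vstar i = (((σ i : ℕ) : ℝ) + 1 / 2) / N) :
    Tendsto v atTop (nhds vstar) ∧
    (∀ w : Fin N → ℝ, (∀ i, w i ∈ Set.Ioo (0 : ℝ) 1) →
      StrictMono (fun i => w (σ.symm i)) →
      energyOnes a n vstar ≤ energyOnes a n w) ∧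
    (∀ w : Fin N → ℝ, (∀ i, w i ∈ Set.Ioo (0 : ℝ) 1) →
      StrictMono (fun i => w (σ.symm i)) →
      energyOnes a n w = energyOnes a n vstar → w = vstar) := by
  obtain ⟨m, rfl⟩ : ∃ m, n = m + 1 := ⟨n - 1, by omega⟩
  have hp : Odd (2 * m + 1) := odd_two_mul_add_one m
  have hN0 : (0 : ℝ) < N := by exact_mod_cast hN
  have hcrit := totalRepulsion_equispaced hp σ hvstar
  have hspos : ∀ i, 0 < vstar i := fun i => by rw [hvstar]; positivity
  have hsord : ∀ i j, σ i < σ j → vstar i < vstar j := fun i j h => by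
    have : ((σ i : ℕ) : ℝ) < (σ j : ℕ) := by exact_mod_cast h
    rw [hvstar, hvstar]
    gcongr
  have hmono {w : Fin N → ℝ} (h : StrictMono fun i => w (σ.symm i)) :
      ∀ i j, σ i < σ j → w i < w j := fun i j hij => by simpa using h hij
  have hmin : ∀ w : Fin N → ℝ, (∀ i, w i ∈ Ioo (0 : ℝ) 1) → StrictMono (fun i => w (σ.symm i)) →
      w ≠ vstar → energyOnes a (m + 1) vstar < energyOnes a (m + 1) w := fun w hw hwσ =>
    energyOnes_lt ha m (fun i => (hw i).1) hspos
      (sign_sub_eq_of_same_order σ.injective (hmono hwσ) hsord) hcrit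
  refine ⟨?_, fun w hw hwσ => ?_, fun w hw hwσ he => ?_⟩
  rotate_left
  · rcases eq_or_ne w vstar with rfl | h
    · exact le_rfl
    · exact (hmin w hw hwσ h).le
  · by_contra h
    exact (hmin w hw hwσ h).ne' he
  set c : ℝ := 2 * a * (m + 1)
  have hc0 : 0 < c := by positivity
  have hderiv : ∀ t, 0 ≤ t → Function.Injective (v t) → ∀ i,
      HasDerivAt (fun s => v s i) (c * totalRepulsion (2 * m + 1) (v t) i) t := by
    intro t ht hinj i
    have := hode t ht i
    rwa [fderiv_energyOnes_single a m (fun i => (hmem t ht i).1) hinj, neg_neg] at this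
  have hinj0 : Function.Injective (v 0) := fun i j h => by
    by_contra hne
    exact hdist i j hne h
  have hord : ∀ t, 0 ≤ t → ∀ i j, σ i < σ j → v t i < v t j := fun t ht i j hij =>
    lt_of_repulsive_flow hc0.le hmem (fun t ht i => (hode t ht i).continuousAt) hderiv hinj0 ht
      (hmono hσ i j hij)
  have hinj : ∀ t, 0 ≤ t → Function.Injective (v t) := fun t ht i j h => by
    by_contra hne
    rcases (σ.injective.ne hne).lt_or_gt with h' | h'
    · exact (hord t ht i j h').ne h
    · exact (hord t ht j i h').ne' h
  have hV : ∀ t, 0 ≤ t → HasDerivAt (fun t => ∑ i, (v t i - vstar i) ^ 2)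
      (c * (2 * ∑ i, (v t i - vstar i) * totalRepulsion (2 * m + 1) (v t) i)) t := by
    intro t ht
    refine (HasDerivAt.fun_sum fun i _ =>
      ((hderiv t ht (hinj t ht) i).sub_const (vstar i)).pow 2).congr_deriv ?_
    simp only [Finset.mul_sum]
    refine Finset.sum_congr rfl fun i _ => ?_
    norm_num
    ring
  have hdiss (t : ℝ) (ht : 0 ≤ t) :=
    two_mul_sum_mul_totalRepulsion_le hp (fun i => (hmem t ht i).1) hspos
      (sign_sub_eq_of_same_order σ.injective (hord t ht) hsord) hcrit
  refine tendsto_pi_nhds.2 fun i => Metric.tendsto_nhds.2 fun ε hε => ?_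
  obtain ⟨δ, hδ, hbound⟩ := exists_dissipation_bound hp vstar (pow_pos hε 2)
  have hev := eventually_lt_of_deriv_le_neg (ε := ε ^ 2) (mul_pos hc0 hδ)
    (fun t _ => Finset.sum_nonneg fun i _ => sq_nonneg (v t i - vstar i)) hV
    (fun t ht => mul_nonpos_of_nonneg_of_nonpos hc0.le ((hdiss t ht).trans
      (Finset.sum_nonpos fun i _ => pow_sub_mul_nonpos hp _ _)))
    (fun t ht hε => by
      rw [← mul_neg]
      exact mul_le_mul_of_nonneg_left ((hdiss t ht).trans
        (hbound (v t) (fun i => Ioo_subset_Icc_self (hmem t ht i)) hε)) hc0.le)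
  filter_upwards [hev] with t ht
  rw [Real.dist_eq]
  exact abs_lt_of_sq_lt_sq ((Finset.single_le_sum (fun i _ => sq_nonneg (v t i - vstar i))
    (Finset.mem_univ i)).trans_lt ht) hε.le
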